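/- arXiv:2309.11007 — 2 statements merged into one kernel-verified Lean document; each statement's English description precedes it below -/
import Mathlib

section
/- Let G be the rooted ball of radius i ≥ 2 around a vertex x of degree α, and assume G is a tree, |S₂(x)| ≤ s·α with s = o(α), and every vertex other than x has degree at most t ≤ α/5. Then the largest eigenvalue μ of the adjacency matrix of G satisfies μ = √α + O(s/√α); explicitly √α ≤ μ ≤ √α + C·s/√α for an absolute constant C (for α large enough relative to s). -/
open Finset

namespace SimpleGraph

variable {V : Type*} {G : SimpleGraph V}

/-- In a tree, a vertex has at most one neighbour closer to a given root. -/
theorem IsTree.eq_of_adj_of_dist_eq (hG : G.IsTree) {x u v w : V}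
    (hv : G.Adj v u) (hw : G.Adj w u)
    (hdv : G.dist x u = G.dist x v + 1) (hdw : G.dist x u = G.dist x w + 1) : v = w := by
  obtain ⟨p, -, hp⟩ := hG.connected.exists_path_of_dist x v
  obtain ⟨q, -, hq⟩ := hG.connected.exists_path_of_dist x w
  have hp' : (p.concat hv).IsPath :=
    Walk.isPath_of_length_eq_dist _ (by rw [Walk.length_concat]; omega)
  have hq' : (q.concat hw).IsPath :=
    Walk.isPath_of_length_eq_dist _ (by rw [Walk.length_concat]; omega)
  have h := (hG.existsUnique_path x u).unique hp' hq'
  simpa using congrArg Walk.penultimate h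

variable [Fintype V] [DecidableRel G.Adj]

variable (G) in
/-- The neighbours of `u` that are one step further from the root `x` than `u`. -/
noncomputable def childFinset (x u : V) : Finset V :=
  {v ∈ G.neighborFinset u | G.dist x v = G.dist x u + 1}

theorem mem_childFinset {x u v : V} :
    v ∈ G.childFinset x u ↔ G.Adj u v ∧ G.dist x v = G.dist x u + 1 := by
  simp [childFinset]

theorem card_childFinset_le_degree (x u : V) : #(G.childFinset x u) ≤ G.degree u :=
  card_filter_le _ _

theorem IsTree.card_neighborFinset_filter_not_child_le_one (hG : G.IsTree) (x u : V) :
    #{v ∈ G.neighborFinset u | ¬ G.dist x v = G.dist x u + 1} ≤ 1 := by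
  rw [card_le_one]
  intro v hv w hw
  simp only [mem_filter, mem_neighborFinset] at hv hw
  have h₁ := hG.dist_eq_dist_add_one_of_adj x hv.1
  have h₂ := hG.dist_eq_dist_add_one_of_adj x hw.1
  exact hG.eq_of_adj_of_dist_eq hv.1.symm hw.1.symm (h₁.resolve_right hv.2)
    (h₂.resolve_right hw.2)

theorem IsTree.sum_card_childFinset_le (hG : G.IsTree) (x : V) :
    ∑ y ∈ G.neighborFinset x, #(G.childFinset x y) ≤ #{v : V | G.dist x v = 2} := by
  classical
  rw [← card_biUnion]
  · refine card_le_card fun v hv ↦ ?_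
    simp only [mem_biUnion, mem_neighborFinset, mem_childFinset] at hv
    obtain ⟨y, hy, -, hv⟩ := hv
    rw [dist_eq_one_iff_adj.mpr hy] at hv
    simpa using hv
  · intro y _ z _ hyz
    refine Finset.disjoint_left.mpr fun v hv hv' ↦ hyz ?_
    rw [mem_childFinset] at hv hv'
    exact hG.eq_of_adj_of_dist_eq hv.1 hv'.1 hv.2 hv'.2

variable [DecidableEq V]

/-- Weighted arithmetic-geometric mean bound for adjacency eigenvalues: it suffices to put
reciprocal weights on the two orientations of each edge with all out-weights at most `c`. -/
theorem le_of_mem_spectrum_adjMatrix_of_edge_weights {μ c : ℝ}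
    (hμ : μ ∈ spectrum ℝ (G.adjMatrix ℝ)) (w : V → V → ℝ)
    (hw : ∀ u v, G.Adj u v → 0 < w u v) (hmul : ∀ u v, G.Adj u v → w u v * w v u = 1)
    (hsum : ∀ u, ∑ v ∈ G.neighborFinset u, w u v ≤ c) : μ ≤ c := by
  rw [← Matrix.spectrum_toLin', ← Module.End.hasEigenvalue_iff_mem_spectrum] at hμ
  obtain ⟨f, hf⟩ := hμ.exists_hasEigenvector
  have hf₀ : f ≠ 0 := hf.2
  have hf' : ∀ u, ∑ v ∈ G.neighborFinset u, f v = μ * f u := fun u ↦ by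
    have h := congrFun hf.apply_eq_smul u
    simpa [Matrix.toLin'_apply, adjMatrix_mulVec_apply] using h
  have hpos : 0 < ∑ u, f u ^ 2 := by
    obtain ⟨u, hu⟩ := Function.ne_iff.mp hf₀
    exact sum_pos' (fun _ _ ↦ sq_nonneg _) ⟨u, mem_univ _, by positivity [show f u ≠ 0 from hu]⟩
  have hedge : ∀ u v, G.Adj u v → 2 * (f u * f v) ≤ w u v * f u ^ 2 + w v u * f v ^ 2 := by
    intro u v h
    have h₁ := hw u v h
    have h₂ := hmul u v h
    have h₃ : w v u = (w u v)⁻¹ := eq_inv_of_mul_eq_one_right h₂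
    have h₄ : w u v * f u ^ 2 + w v u * f v ^ 2 - 2 * (f u * f v)
        = w u v * (f u - (w u v)⁻¹ * f v) ^ 2 := by
      rw [h₃]; field_simp; ring
    have := mul_nonneg h₁.le (sq_nonneg (f u - (w u v)⁻¹ * f v))
    linarith
  have hswap : ∑ u, ∑ v ∈ G.neighborFinset u, w v u * f v ^ 2
      = ∑ u, ∑ v ∈ G.neighborFinset u, w u v * f u ^ 2 :=
    sum_comm' fun u v ↦ by simp [adj_comm]
  have hle : ∑ u, ∑ v ∈ G.neighborFinset u, w u v * f u ^ 2 ≤ c * ∑ u, f u ^ 2 := by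
    rw [mul_sum]
    refine sum_le_sum fun u _ ↦ ?_
    rw [← sum_mul]
    exact mul_le_mul_of_nonneg_right (hsum u) (sq_nonneg _)
  have htwo : 2 * (μ * ∑ u, f u ^ 2)
      ≤ ∑ u, ∑ v ∈ G.neighborFinset u, (w u v * f u ^ 2 + w v u * f v ^ 2) := by
    rw [mul_sum, mul_sum]
    refine sum_le_sum fun u _ ↦ ?_
    calc 2 * (μ * f u ^ 2) = ∑ v ∈ G.neighborFinset u, 2 * (f u * f v) := by
          rw [← mul_sum, ← mul_sum, hf']; ring
      _ ≤ _ := sum_le_sum fun v hv ↦ hedge u v ((mem_neighborFinset ..).mp hv)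
  simp only [sum_add_distrib, hswap] at htwo
  exact le_of_mul_le_mul_right (by linarith) hpos

/-- The largest adjacency eigenvalue of a graph is at least the square root of any degree. -/
theorem sqrt_degree_le_of_isGreatest_spectrum {μ : ℝ}
    (hμ : IsGreatest (spectrum ℝ (G.adjMatrix ℝ)) μ) (x : V) : √(G.degree x) ≤ μ := by
  have hpsd : (algebraMap ℝ (Matrix V V ℝ) μ - G.adjMatrix ℝ).PosSemidef := by
    rw [Matrix.posSemidef_iff_isHermitian_and_spectrum_nonneg]
    constructor
    · refine Matrix.IsHermitian.sub ?_ ?_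
      · rw [Matrix.algebraMap_eq_diagonal]
        exact Matrix.isHermitian_diagonal _
      · ext u v
        simp [adjMatrix_apply, adj_comm]
    · rw [← spectrum.singleton_sub_eq]
      rintro _ ⟨_, rfl, b, hb, rfl⟩
      exact sub_nonneg.mpr (hμ.2 hb)
  have hrayleigh : ∀ f : V → ℝ,
      ∑ u, f u * ∑ v ∈ G.neighborFinset u, f v ≤ μ * ∑ u, f u ^ 2 := fun f ↦ by
    have h := hpsd.dotProduct_mulVec_nonneg f
    rw [Matrix.sub_mulVec, dotProduct_sub, sub_nonneg, Algebra.algebraMap_eq_smul_one,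
      Matrix.smul_mulVec, Matrix.one_mulVec] at h
    simpa [dotProduct, adjMatrix_mulVec_apply, mul_sum, sq, mul_left_comm] using h
  set q := √(G.degree x : ℝ) with hq
  have hq₀ : 0 ≤ q := Real.sqrt_nonneg _
  have hq₂ : q ^ 2 = G.degree x := Real.sq_sqrt (Nat.cast_nonneg _)
  let f : V → ℝ := fun v ↦ if v = x then q else if G.Adj x v then 1 else 0
  have hf₀ : ∀ v, 0 ≤ f v := fun v ↦ by dsimp only [f]; split_ifs <;> positivity
  have hfx : f x = q := by simp [f]
  have hfy : ∀ v ∈ G.neighborFinset x, f v = 1 := fun v hv ↦ by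
    have hv := (mem_neighborFinset ..).mp hv
    simp [f, hv, hv.ne']
  have hnorm : ∑ u, f u ^ 2 = 2 * q ^ 2 := by
    rw [← add_sum_erase _ _ (mem_univ x), hfx,
      ← sum_subset (s₁ := G.neighborFinset x), sum_congr rfl fun v hv ↦ by rw [hfy v hv]]
    · simp [hq₂, two_mul]
    · intro v hv
      simpa using ((mem_neighborFinset ..).mp hv).ne'
    · intro v hv hv'
      have h₁ : v ≠ x := by simpa using hv
      have h₂ : ¬ G.Adj x v := by simpa using hv'
      simp [f, h₁, h₂]
  have henergy : 2 * q ^ 3 ≤ ∑ u, f u * ∑ v ∈ G.neighborFinset u, f v := by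
    rw [← add_sum_erase _ _ (mem_univ x), hfx, sum_congr rfl hfy]
    have h : ∑ u ∈ G.neighborFinset x, q
        ≤ ∑ u ∈ univ.erase x, f u * ∑ v ∈ G.neighborFinset u, f v := by
      calc ∑ u ∈ G.neighborFinset x, q
          ≤ ∑ u ∈ G.neighborFinset x, f u * ∑ v ∈ G.neighborFinset u, f v := by
            refine sum_le_sum fun u hu ↦ ?_
            rw [hfy u hu, one_mul, ← hfx]
            refine single_le_sum (fun v _ ↦ hf₀ v) ?_
            simpa [adj_comm] using hu
        _ ≤ _ := by
            refine sum_le_sum_of_subset_of_nonneg (fun v hv ↦ ?_) fun v _ _ ↦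
              mul_nonneg (hf₀ v) (sum_nonneg fun v _ ↦ hf₀ v)
            simpa using ((mem_neighborFinset ..).mp hv).ne'
    simp only [sum_const, card_neighborFinset_eq_degree, nsmul_eq_mul, ← hq₂] at h ⊢
    linarith
  have h := hrayleigh f
  rw [hnorm] at h
  rcases hq₀.eq_or_lt with h₀ | h₀
  · have hfree := hrayleigh fun _ ↦ 1
    have h₁ : 0 ≤ μ * ∑ _u : V, (1 : ℝ) ^ 2 :=
      le_trans (sum_nonneg fun u _ ↦ by positivity) hfree
    rw [← h₀]
    refine nonneg_of_mul_nonneg_left h₁ ?_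
    simp [Fintype.card_pos_iff.mpr ⟨x⟩]
  · have : q * (2 * q ^ 2) ≤ μ * (2 * q ^ 2) := by linarith
    exact le_of_mul_le_mul_right this (by positivity)

/-- Upper bound on the adjacency eigenvalues of a tree whose root dominates all degrees. -/
theorem IsTree.le_sqrt_degree_add_of_mem_spectrum (hG : G.IsTree) {x : V} {s μ : ℝ}
    (hs : 0 ≤ s) (hx : 0 < G.degree x)
    (hS : (#{v : V | G.dist x v = 2} : ℝ) ≤ s * G.degree x)
    (hdeg : ∀ v, v ≠ x → (G.degree v : ℝ) ≤ G.degree x / 5)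
    (hμ : μ ∈ spectrum ℝ (G.adjMatrix ℝ)) :
    μ ≤ √(G.degree x) + 5 / 3 * s / √(G.degree x) := by
  have hq₀ : 0 < √(G.degree x : ℝ) := Real.sqrt_pos.mpr (by exact_mod_cast hx)
  have hq₂ : (G.degree x : ℝ) = √(G.degree x : ℝ) ^ 2 :=
    (Real.sq_sqrt (Nat.cast_nonneg _)).symm
  generalize √(G.degree x : ℝ) = q at hq₀ hq₂ ⊢
  set c := q + 5 / 3 * s / q with hc
  have hqc : q ≤ c := le_add_of_nonneg_right (by positivity)
  have hc₀ : 0 < c := hq₀.trans_le hqc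
  have hc₂ : q ^ 2 + 10 / 3 * s ≤ c ^ 2 := by
    have : c ^ 2 = q ^ 2 + 10 / 3 * s + (5 / 3 * s / q) ^ 2 := by rw [hc]; field_simp; ring
    rw [this]
    exact le_add_of_nonneg_right (sq_nonneg _)
  let z : V → ℝ := fun u ↦ 2 / q * #(G.childFinset x u)
  have hz₀ : ∀ u, 0 ≤ z u := fun u ↦ by positivity
  have hzq : ∀ u, u ≠ x → z u ≤ 2 / 5 * q := fun u hu ↦ by
    have h₁ : (#(G.childFinset x u) : ℝ) ≤ q ^ 2 / 5 :=
      (Nat.cast_le.mpr (card_childFinset_le_degree x u)).trans (hq₂ ▸ hdeg u hu)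
    calc z u ≤ 2 / q * (q ^ 2 / 5) := mul_le_mul_of_nonneg_left h₁ (by positivity)
      _ = 2 / 5 * q := by field_simp
  have hcz : ∀ u, u ≠ x → q / 2 ≤ c - z u := fun u hu ↦ by linarith [hzq u hu]
  have hcz₀ : ∀ u, u ≠ x → 0 < c - z u := fun u hu ↦ by linarith [hcz u hu]
  refine le_of_mem_spectrum_adjMatrix_of_edge_weights hμ
    (fun u v ↦ if u = x then (c - z v)⁻¹ else if v = x then c - z u else
      if G.dist x v = G.dist x u + 1 then 2 / q else q / 2) ?_ ?_ ?_
  · intro u v huv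
    split_ifs with h₁ h₂ h₃
    · exact inv_pos.mpr (hcz₀ v (h₁ ▸ huv.ne'))
    · exact hcz₀ u h₁
    · positivity
    · positivity
  · intro u v huv
    by_cases hu : u = x
    · have hv : v ≠ x := hu ▸ huv.ne'
      simp [hu, hv, (hcz₀ v hv).ne']
    · by_cases hv : v = x
      · simp [hu, hv, (hcz₀ u hu).ne']
      · have hd := hG.dist_eq_dist_add_one_of_adj x huv
        by_cases h : G.dist x v = G.dist x u + 1
        · simp only [hu, hv, h, if_true, if_false]
          rw [if_neg (by omega)]
          field_simp
        · have h' := hd.resolve_right h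
          simp only [hu, hv, if_false]
          rw [if_neg h, if_pos h']
          field_simp
  · intro u
    by_cases hu : u = x
    · subst hu
      simp only [if_true]
      have hterm : ∀ y ∈ G.neighborFinset u,
          (c - z y)⁻¹ ≤ 1 / c + 5 / (3 * c ^ 2) * z y := fun y hy ↦ by
        have hy : y ≠ u := ((mem_neighborFinset ..).mp hy).ne'
        have h₁ := hcz₀ y hy
        have h₂ : z y ≤ 2 / 5 * c := (hzq y hy).trans (by linarith)
        have h₃ : 1 / c + 5 / (3 * c ^ 2) * z y = (3 * c + 5 * z y) / (3 * c ^ 2) := by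
          field_simp
        rw [h₃, inv_eq_one_div, div_le_div_iff₀ h₁ (by positivity)]
        nlinarith [mul_nonneg (hz₀ y) (sub_nonneg.mpr h₂)]
      have hzsum : ∑ y ∈ G.neighborFinset u, z y ≤ 2 * s * q := by
        have h : ((∑ y ∈ G.neighborFinset u, #(G.childFinset u y) : ℕ) : ℝ) ≤ s * q ^ 2 :=
          (Nat.cast_le.mpr (hG.sum_card_childFinset_le u)).trans (hq₂ ▸ hS)
        rw [← mul_sum, ← Nat.cast_sum]
        calc _ ≤ 2 / q * (s * q ^ 2) := mul_le_mul_of_nonneg_left h (by positivity)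
          _ = 2 * s * q := by field_simp
      calc ∑ y ∈ G.neighborFinset u, (c - z y)⁻¹
          ≤ ∑ y ∈ G.neighborFinset u, (1 / c + 5 / (3 * c ^ 2) * z y) := sum_le_sum hterm
        _ = q ^ 2 * (1 / c) + 5 / (3 * c ^ 2) * ∑ y ∈ G.neighborFinset u, z y := by
            rw [sum_add_distrib, ← mul_sum, sum_const, card_neighborFinset_eq_degree,
              nsmul_eq_mul, hq₂]
        _ ≤ q ^ 2 * (1 / c) + 5 / (3 * c ^ 2) * (2 * s * q) := by gcongr
        _ = (q ^ 2 * c + 10 / 3 * s * q) / c ^ 2 := by field_simp; ring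
        _ ≤ c := by
            rw [div_le_iff₀ (by positivity)]
            nlinarith [mul_le_mul_of_nonneg_left hc₂ hc₀.le, mul_le_mul_of_nonneg_left hqc hs]
    · simp only [hu, if_false]
      rw [← sum_filter_add_sum_filter_not _ fun v ↦ G.dist x v = G.dist x u + 1]
      have hchild : ∑ v ∈ G.neighborFinset u with G.dist x v = G.dist x u + 1,
          (if v = x then c - z u else if G.dist x v = G.dist x u + 1 then 2 / q else q / 2)
            = z u := by
        have : ∀ v ∈ G.childFinset x u, (if v = x then c - z u else
            if G.dist x v = G.dist x u + 1 then 2 / q else q / 2) = 2 / q := fun v hv ↦ by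
          have hv := (mem_childFinset.mp hv).2
          have hvx : v ≠ x := by
            rintro rfl
            simp at hv
          rw [if_neg hvx, if_pos hv]
        rw [← childFinset, sum_congr rfl this, sum_const, nsmul_eq_mul, mul_comm]
      have hparent : ∑ v ∈ G.neighborFinset u with ¬ G.dist x v = G.dist x u + 1,
          (if v = x then c - z u else if G.dist x v = G.dist x u + 1 then 2 / q else q / 2)
            ≤ c - z u := by
        refine (sum_le_card_nsmul _ _ (c - z u) fun v hv ↦ ?_).trans ?_
        · rw [if_neg (mem_filter.mp hv).2]
          split_ifs
          exacts [le_rfl, hcz u hu]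
        · rw [nsmul_eq_mul]
          refine mul_le_of_le_one_left (hcz₀ u hu).le ?_
          exact_mod_cast hG.card_neighborFinset_filter_not_child_le_one x u
      linarith

end SimpleGraph


/-- The largest eigenvalue of the ball of radius `i ≥ 2` around a vertex `x` of degree `α`:
if the ball is a tree, `|S₂(x)| ≤ s·α`, and all other vertices have degree at most
`t ≤ α/5`, then for `α` large enough relative to `s`, the maximal eigenvalue `μ` of the
adjacency matrix satisfies `√α ≤ μ ≤ √α + C·s/√α` for an absolute constant `C`. -/
theorem ball_top_eigenvalue :
    ∃ C : ℝ, 0 < C ∧ ∀ s : ℝ, 0 ≤ s → ∃ A₀ : ℝ,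
      ∀ (V : Type) [Fintype V] [DecidableEq V] (G : SimpleGraph V) [DecidableRel G.Adj]
        (x : V) (i : ℕ) (t : ℝ) (μ : ℝ),
        G.IsTree → 2 ≤ i → (∀ v : V, G.dist x v ≤ i) →
        A₀ ≤ (G.degree x : ℝ) →
        ((Finset.univ.filter fun v : V => G.dist x v = 2).card : ℝ) ≤ s * (G.degree x : ℝ) →
        (∀ v : V, v ≠ x → (G.degree v : ℝ) ≤ t) →
        t ≤ (G.degree x : ℝ) / 5 →
        IsGreatest (spectrum ℝ (G.adjMatrix ℝ)) μ →
        Real.sqrt (G.degree x) ≤ μ ∧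
          μ ≤ Real.sqrt (G.degree x) + C * s / Real.sqrt (G.degree x) := by
  refine ⟨5 / 3, by norm_num, fun s hs ↦ ⟨1, ?_⟩⟩
  intro V _ _ G _ x i t μ hG _ _ hA hS hdeg ht hμ
  refine ⟨G.sqrt_degree_le_of_isGreatest_spectrum hμ x, ?_⟩
  exact hG.le_sqrt_degree_add_of_mem_spectrum hs (by exact_mod_cast hA) hS
    (fun v hv ↦ (hdeg v hv).trans ht) hμ.1
end

section
/- Let G be a star graph with center x of degree α plus, for each neighbor y of x, an arbitrary set of pendant paths, such that the whole graph B is a tree of depth 2 rooted at x: x has α children, and the children have β total children (|S₂| = β). Consider the vector w with w(x) = √α / √(2(α + β/α)), w(y) = 1/√(2α) for y ∈ S₁, and w(z) = 1/√(2α(α+β/α)) for z ∈ S₂. Then w is a unit vector and ‖A_B w − λ w‖² ≤ (1/(2α(α+β/α))) Σ_{y∈S₁}(N_y − β/α)², where λ = √(α + β/α) and N_y is the number of children of y. -/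
/-- In the graph `G` viewed as rooted at `x`, the children of `v`: neighbors of `v`
strictly farther from the root `x`. -/
noncomputable def rootedChildren {V : Type*} [Fintype V] [DecidableEq V] (G : SimpleGraph V)
    [DecidableRel G.Adj] (x v : V) : Finset V :=
  (G.neighborFinset v).filter fun y => G.dist x v < G.dist x y

namespace SimpleGraph.IsTree

variable {V : Type*} {G : SimpleGraph V}

/-- In a tree, two vertices at distance two have a unique common neighbor. -/
lemma eq_of_adj_of_dist_eq_two (hG : G.IsTree) {x z u v : V} (hz : G.dist x z = 2)
    (hxu : G.Adj x u) (huz : G.Adj u z) (hxv : G.Adj x v) (hvz : G.Adj v z) : u = v := by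
  have hp : (Walk.cons hxu (Walk.cons huz Walk.nil)).IsPath :=
    Walk.isPath_of_length_eq_dist _ (by simp [hz])
  have hq : (Walk.cons hxv (Walk.cons hvz Walk.nil)).IsPath :=
    Walk.isPath_of_length_eq_dist _ (by simp [hz])
  have h := congrArg (fun p => p.1.snd)
    ((hG.isAcyclic.subsingleton_path x z).elim ⟨_, hp⟩ ⟨_, hq⟩)
  simpa using h

variable [Fintype V] [DecidableRel G.Adj]

/-- In a tree of depth two, a vertex of the second sphere has its parent as only neighbor. -/
lemma exists_neighborFinset_eq_singleton (hG : G.IsTree) {x z : V}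
    (hdepth : ∀ v, G.dist x v ≤ 2) (hz : G.dist x z = 2) :
    ∃ y, G.Adj x y ∧ G.neighborFinset z = {y} := by
  have hnbr : ∀ u, G.Adj z u → G.Adj x u := fun u hu => by
    rw [← dist_eq_one_iff_adj]
    have := hG.dist_eq_dist_add_one_of_adj x hu
    have := hdepth u
    omega
  have hzx : z ≠ x := by
    rintro rfl
    simp at hz
  have : Nontrivial V := ⟨z, x, hzx⟩
  obtain ⟨y, hy⟩ := hG.connected.preconnected.exists_adj_of_nontrivial z
  refine ⟨y, hnbr y hy, ?_⟩
  ext u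
  simp only [mem_neighborFinset, Finset.mem_singleton]
  exact ⟨fun hu => hG.eq_of_adj_of_dist_eq_two hz (hnbr u hu) hu.symm (hnbr y hy) hy.symm,
    fun h => h ▸ hy⟩

variable [DecidableEq V]

/-- The neighbors of a child of the root are the root and its own children. -/
lemma neighborFinset_eq_insert_rootedChildren (hG : G.IsTree) {x y : V} (hxy : G.Adj x y) :
    G.neighborFinset y = insert x (rootedChildren G x y) := by
  ext u
  simp only [rootedChildren, Finset.mem_insert, Finset.mem_filter, mem_neighborFinset]
  have h1 : G.dist x y = 1 := dist_eq_one_iff_adj.mpr hxy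
  constructor
  · intro hu
    rcases hG.dist_eq_dist_add_one_of_adj x hu with h | h
    · exact Or.inl (hG.connected.dist_eq_zero_iff.mp (by omega : G.dist x u = 0)).symm
    · exact Or.inr ⟨hu, by omega⟩
  · rintro (rfl | h)
    exacts [hxy.symm, h.1]

/-- A sum over a tree of depth two splits into the root and the two spheres around it. -/
lemma sum_univ_eq_of_dist_le_two {M : Type*} [AddCommMonoid M] (hG : G.IsTree) {x : V}
    (hdepth : ∀ v, G.dist x v ≤ 2) (f : V → M) :
    ∑ v, f v = f x + (∑ y ∈ G.neighborFinset x, f y + ∑ z with G.dist x z = 2, f z) := by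
  have huniv : (Finset.univ : Finset V) =
      insert x (G.neighborFinset x ∪ Finset.univ.filter fun z => G.dist x z = 2) := by
    ext v
    have h0 : G.dist x v = 0 ↔ x = v := hG.connected.dist_eq_zero_iff
    have h1 : G.dist x v = 1 ↔ G.Adj x v := dist_eq_one_iff_adj
    have := hdepth v
    simp only [Finset.mem_univ, Finset.mem_insert, Finset.mem_union, mem_neighborFinset,
      Finset.mem_filter, true_and, true_iff, ← h1, eq_comm (a := v), ← h0]
    omega
  rw [← Finset.sum_union, ← Finset.sum_insert (by simp), ← huniv]
  rw [Finset.disjoint_left]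
  intro v hv hv'
  have h1 : G.dist x v = 1 := dist_eq_one_iff_adj.mpr (by simpa using hv)
  simp [h1] at hv'

end SimpleGraph.IsTree

/-- The residual of the explicit test vector on a rooted tree `B` of depth 2:
with `α = deg x`, `β = |S₂(x)|`, `λ = √(α+β/α)`, and the vector `w` given by
`w(x) = √α/√(2(α+β/α))`, `w|_{S₁} = 1/√(2α)`, `w|_{S₂} = 1/√(2α(α+β/α))`,
`w` is a unit vector and
`‖A_B w − λ w‖² ≤ (1/(2α(α+β/α))) Σ_{y∈S₁} (N_y − β/α)²`. -/
theorem depth_two_tree_test_vector {V : Type*} [Fintype V] [DecidableEq V]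
    (G : SimpleGraph V) [DecidableRel G.Adj] (x : V)
    (htree : G.IsTree) (hdepth : ∀ v : V, G.dist x v ≤ 2)
    (α β : ℝ) (hα : α = (G.degree x : ℝ)) (hα0 : 0 < α)
    (hβ : β = ((Finset.univ.filter fun v : V => G.dist x v = 2).card : ℝ))
    (w : V → ℝ)
    (hw : w = fun v =>
      if v = x then Real.sqrt α / Real.sqrt (2 * (α + β / α))
      else if G.dist x v = 1 then 1 / Real.sqrt (2 * α)
      else 1 / Real.sqrt (2 * α * (α + β / α))) :
    (∑ v : V, (w v) ^ 2 = 1) ∧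
    (∑ v : V, ((G.adjMatrix ℝ).mulVec w v - Real.sqrt (α + β / α) * w v) ^ 2 ≤
      (1 / (2 * α * (α + β / α))) *
        ∑ y ∈ G.neighborFinset x, (((rootedChildren G x y).card : ℝ) - β / α) ^ 2) := by
  have hβ0 : 0 ≤ β := hβ ▸ Nat.cast_nonneg _
  obtain ⟨L, hL⟩ : ∃ L, L = α + β / α := ⟨_, rfl⟩
  have hL0 : 0 < L := hL ▸ by positivity
  have hαL : α * L = α ^ 2 + β := by rw [hL]; field_simp
  rw [← hL] at hw ⊢
  obtain ⟨c, hc⟩ : ∃ c, c = 1 / Real.sqrt (2 * α * L) := ⟨_, rfl⟩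
  have hc2 : c ^ 2 = 1 / (2 * α * L) := by
    rw [hc, div_pow, Real.sq_sqrt (by positivity), one_pow]
  have hsL : Real.sqrt L ^ 2 = L := Real.sq_sqrt hL0.le
  have hwx : w x = α * c := by
    have hsα : Real.sqrt α ^ 2 = α := Real.sq_sqrt hα0.le
    have : Real.sqrt (2 * α * L) = Real.sqrt (2 * L) * Real.sqrt α := by
      rw [← Real.sqrt_mul (by positivity)]
      ring_nf
    simp only [hw, if_true, hc, this]
    field_simp
    exact hsα
  have hwy : ∀ y, G.Adj x y → w y = Real.sqrt L * c := fun y hy => by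
    have : Real.sqrt (2 * α * L) = Real.sqrt (2 * α) * Real.sqrt L :=
      Real.sqrt_mul (by positivity) _
    simp only [hw, if_neg hy.ne.symm, SimpleGraph.dist_eq_one_iff_adj.mpr hy, if_true, hc, this]
    field_simp
  have hwz : ∀ z, G.dist x z = 2 → w z = c := fun z hz => by
    have hzx : z ≠ x := by
      rintro rfl
      simp at hz
    have hz1 : G.dist x z ≠ 1 := by omega
    rw [hw, hc]
    exact (if_neg hzx).trans (if_neg hz1)
  constructor
  · have hfst : ∀ y ∈ G.neighborFinset x, w y ^ 2 = (Real.sqrt L * c) ^ 2 := fun y hy => by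
      rw [hwy y (by simpa using hy)]
    have hsnd : ∀ z ∈ Finset.univ.filter fun z => G.dist x z = 2, w z ^ 2 = c ^ 2 :=
      fun z hz => by rw [hwz z (by simpa using hz)]
    rw [htree.sum_univ_eq_of_dist_le_two hdepth, Finset.sum_congr rfl hfst,
      Finset.sum_congr rfl hsnd,
      Finset.sum_const, Finset.sum_const, nsmul_eq_mul, nsmul_eq_mul, ← hβ,
      SimpleGraph.card_neighborFinset_eq_degree, ← hα, hwx, mul_pow, mul_pow, hsL, hc2]
    field_simp
    linarith
  · refine le_of_eq ?_
    have hroot : (G.adjMatrix ℝ).mulVec w x - Real.sqrt L * w x = 0 := by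
      rw [SimpleGraph.adjMatrix_mulVec_apply,
        Finset.sum_congr rfl fun y hy => hwy y (by simpa using hy), Finset.sum_const,
        SimpleGraph.card_neighborFinset_eq_degree, nsmul_eq_mul, ← hα, hwx]
      ring
    have hfst : ∀ y ∈ G.neighborFinset x,
        ((G.adjMatrix ℝ).mulVec w y - Real.sqrt L * w y) ^ 2 =
          1 / (2 * α * L) * (((rootedChildren G x y).card : ℝ) - β / α) ^ 2 := fun y hy => by
      have hxy : G.Adj x y := by simpa using hy
      have hchild : ∀ z ∈ rootedChildren G x y, w z = c := fun z hz => by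
        have hlt := (Finset.mem_filter.mp hz).2
        have := hdepth z
        have := SimpleGraph.dist_eq_one_iff_adj.mpr hxy
        exact hwz z (by omega)
      rw [SimpleGraph.adjMatrix_mulVec_apply, htree.neighborFinset_eq_insert_rootedChildren hxy,
        Finset.sum_insert (by simp [rootedChildren]), Finset.sum_congr rfl hchild,
        Finset.sum_const, nsmul_eq_mul, hwx, hwy y hxy, ← hc2, ← mul_pow]
      congr 1
      linear_combination (-c) * hsL - c * hL
    have hsnd : ∀ z ∈ Finset.univ.filter fun z => G.dist x z = 2,
        ((G.adjMatrix ℝ).mulVec w z - Real.sqrt L * w z) ^ 2 = 0 := fun z hz => by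
      have hz2 : G.dist x z = 2 := by simpa using hz
      obtain ⟨y, hxy, hy⟩ := htree.exists_neighborFinset_eq_singleton hdepth hz2
      rw [SimpleGraph.adjMatrix_mulVec_apply, hy, Finset.sum_singleton, hwy y hxy, hwz z hz2]
      ring
    rw [htree.sum_univ_eq_of_dist_le_two hdepth, hroot, Finset.sum_congr rfl hfst,
      Finset.sum_eq_zero hsnd, Finset.mul_sum]
    ring
end
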